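/- Let n ≥ 1, let 0 = s̃₀ < s̃₁ < ⋯ < s̃ₙ < s̃_{n+1} = 1, let c₁, …, cₙ > 0 and c_{n+1} ≥ 0, and set t₀ := 0 and t_k := c₁ + ⋯ + c_k for 1 ≤ k ≤ n. Then the following identity of absolutely convergent Lebesgue integrals holds: ∫_{(0,∞)^{n+1}} exp(−Σ_{k=1}^{n+1} c_k x_k) · √(8π) h_{1−s̃₁}(x₁) h̃_{s̃₁}(x₁) · Π_{k=1}^{n−1} [ (h̃_{s̃_{k+1}}(x_{k+1}) / h̃_{s̃_k}(x_k)) · p̃_{s̃_{k+1}−s̃_k}(x_k, x_{k+1}) ] · ( p̃_{1−s̃ₙ}(xₙ, x_{n+1}) / (2 h̃_{s̃ₙ}(xₙ)) ) dx₁⋯dx_{n+1} = √(2/π) ∫_{(0,∞)^{n+1}} exp(−(1/2) Σ_{k=0}^{n} (s̃_{k+1} − s̃_k) y_k²) · (c_{n+1}² + yₙ²)^{−1} · Π_{k=1}^{n} q_{t_k − t_{k−1}}(y_{k−1}, y_k) · y₀² dy₀⋯dyₙ. (The left side is E[exp(−Σ_{k=1}^{n+1} c_k B^{me}_{s̃_k})]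 with s̃_{n+1} = 1 for the Brownian meander B^{me}, and the right side its dual representation in terms of the radial part of a three-dimensional Cauchy process.) -/

import Mathlib

open MeasureTheory

/-- Transition subprobability density of Brownian motion killed at 0. -/
noncomputable def ptilde (t x₁ x₂ : ℝ) : ℝ :=
  (Real.sqrt (2 * Real.pi * t))⁻¹ *
    (Real.exp (-(x₁ - x₂) ^ 2 / (2 * t)) - Real.exp (-(x₁ + x₂) ^ 2 / (2 * t)))

/-- `h_s(x) = x·(2π(1−s)³)^{−1/2}·exp(−x²/(2(1−s)))`. -/
noncomputable def hexc (s x : ℝ) : ℝ :=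
  x / Real.sqrt (2 * Real.pi * (1 - s) ^ 3) * Real.exp (-x ^ 2 / (2 * (1 - s)))

/-- `h̃_s(x) = (2π(1−s))^{−1/2}·∫₀ˣ exp(−u²/(2(1−s))) du`. -/
noncomputable def htil (s x : ℝ) : ℝ :=
  (Real.sqrt (2 * Real.pi * (1 - s)))⁻¹ * ∫ u in (0 : ℝ)..x, Real.exp (-u ^ 2 / (2 * (1 - s)))

/-- Transition density of the radial part of a three-dimensional Cauchy process. -/
noncomputable def qrad (t y₁ y₂ : ℝ) : ℝ :=
  (y₂ / y₁) * (1 / Real.pi) *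
    (t / (t ^ 2 + (y₁ - y₂) ^ 2) - t / (t ^ 2 + (y₁ + y₂) ^ 2))

/-- Extension of a vector `x : Fin n → ℝ` to a function on `ℕ` (by zero). -/
def ext (n : ℕ) (x : Fin n → ℝ) (k : ℕ) : ℝ := if h : k < n then x ⟨k, h⟩ else 0

/-- The Gaussian weight `exp(-δ y² / 2)`. -/
noncomputable def gaussWeight (δ y : ℝ) : ℝ := Real.exp (-(δ / 2) * y ^ 2)

/-- The Cauchy kernel killed at `0` (up to the factor `π⁻¹`). -/
noncomputable def cauchyKernel (c y z : ℝ) : ℝ :=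
  c / (c ^ 2 + (y - z) ^ 2) - c / (c ^ 2 + (y + z) ^ 2)

theorem gaussWeight_pos (δ y : ℝ) : 0 < gaussWeight δ y := Real.exp_pos _

theorem measurable_gaussWeight (δ : ℝ) : Measurable (gaussWeight δ) := by
  unfold gaussWeight; fun_prop

theorem integrable_gaussWeight {δ : ℝ} (hδ : 0 < δ) : Integrable (gaussWeight δ) :=
  integrable_exp_neg_mul_sq (half_pos hδ)

theorem integrable_mul_gaussWeight {δ : ℝ} (hδ : 0 < δ) :
    Integrable fun y => y * gaussWeight δ y :=
  integrable_mul_exp_neg_mul_sq (half_pos hδ)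

theorem measurable_ptilde (t : ℝ) : Measurable fun p : ℝ × ℝ => ptilde t p.1 p.2 := by
  unfold ptilde; fun_prop

theorem measurable_cauchyKernel (c : ℝ) :
    Measurable fun p : ℝ × ℝ => cauchyKernel c p.1 p.2 := by
  unfold cauchyKernel; fun_prop

theorem ptilde_nonneg {t x z : ℝ} (ht : 0 < t) (hx : 0 < x) (hz : 0 < z) :
    0 ≤ ptilde t x z := by
  unfold ptilde
  refine mul_nonneg (by positivity) (sub_nonneg.2 (Real.exp_le_exp.2 ?_))
  exact div_le_div_of_nonneg_right (by nlinarith [mul_pos hx hz]) (by positivity)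

theorem ptilde_le {t : ℝ} (ht : 0 < t) (x z : ℝ) :
    ptilde t x z ≤ (Real.sqrt (2 * Real.pi * t))⁻¹ := by
  unfold ptilde
  have h₁ : Real.exp (-(x - z) ^ 2 / (2 * t)) ≤ 1 :=
    Real.exp_le_one_iff.2 (div_nonpos_of_nonpos_of_nonneg (by nlinarith [sq_nonneg (x - z)])
      (by positivity))
  have h₂ := Real.exp_pos (-(x + z) ^ 2 / (2 * t))
  exact mul_le_of_le_one_right (by positivity) (by linarith)

theorem cauchyKernel_nonneg {c y z : ℝ} (hc : 0 < c) (hy : 0 < y) (hz : 0 < z) :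
    0 ≤ cauchyKernel c y z := by
  unfold cauchyKernel
  exact sub_nonneg.2 (div_le_div_of_nonneg_left hc.le (by positivity)
    (by nlinarith [mul_pos hy hz]))

theorem mul_cauchyKernel_le {c y z : ℝ} (hc : 0 < c) (hy : 0 < y) (hz : 0 < z) :
    y * cauchyKernel c y z ≤ 4 / c * z := by
  unfold cauchyKernel
  rw [div_sub_div _ _ (by positivity) (by positivity), mul_div_assoc', div_mul_eq_mul_div,
    div_le_div_iff₀ (by positivity) hc]
  have h₁ : 0 ≤ 4 * z * (c ^ 2 * (c ^ 2 + z ^ 2 + 2 * y * z) + (y - z) ^ 2 * (c ^ 2 + (y + z) ^ 2)) := by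
    positivity
  nlinarith [h₁]

theorem integrableOn_exp_neg_mul {c : ℝ} (hc : 0 < c) :
    Integrable (fun x => Real.exp (-(c * x))) (volume.restrict (Set.Ioi (0 : ℝ))) := by
  simpa [IntegrableOn] using exp_neg_integrableOn_Ioi 0 hc

theorem integrableOn_mul_exp_neg_mul {c : ℝ} (hc : 0 < c) :
    Integrable (fun x => x * Real.exp (-(c * x))) (volume.restrict (Set.Ioi (0 : ℝ))) := by
  have := integrableOn_rpow_mul_exp_neg_mul_rpow (p := 1) (s := 1) (by norm_num) one_pos hc
  simpa [IntegrableOn] using this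

theorem integral_gaussWeight_mul_cos {δ : ℝ} (hδ : 0 < δ) (a : ℝ) :
    ∫ y in Set.Ioi (0 : ℝ), gaussWeight δ y * Real.cos (a * y)
      = Real.sqrt (2 * Real.pi / δ) / 2 * Real.exp (-a ^ 2 / (2 * δ)) := by
  have hb : 0 < ((δ / 2 : ℝ) : ℂ).re := by simpa using hδ
  have h := congrArg Complex.re (fourierIntegral_gaussian hb (a : ℂ))
  have hint : Integrable fun x : ℝ => Complex.exp (Complex.I * (a : ℂ) * x) *
      Complex.exp (-((δ / 2 : ℝ) : ℂ) * (x : ℂ) ^ 2) := by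
    refine ((integrable_cexp_neg_mul_sq hb).norm).mono' (by fun_prop) (ae_of_all _ fun x => ?_)
    rw [norm_mul, Complex.norm_exp]
    simp
  have hre := integral_re (𝕜 := ℂ) hint
  simp only [RCLike.re_to_complex] at hre
  rw [← hre] at h
  have hl : ∀ x : ℝ, (Complex.exp (Complex.I * (a : ℂ) * x) *
      Complex.exp (-((δ / 2 : ℝ) : ℂ) * (x : ℂ) ^ 2)).re
        = gaussWeight δ |x| * Real.cos (a * |x|) := by
    intro x
    have h₁ : Complex.exp (-((δ / 2 : ℝ) : ℂ) * (x : ℂ) ^ 2) = ((gaussWeight δ |x| : ℝ) : ℂ) := by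
      simp [gaussWeight]
    have h₂ : Complex.I * (a : ℂ) * x = ((a * x : ℝ) : ℂ) * Complex.I := by push_cast; ring
    have h₃ : Real.cos (a * |x|) = Real.cos (a * x) := by
      rcases abs_choice x with h | h <;> simp [h]
    rw [h₁, Complex.re_mul_ofReal, h₂, Complex.exp_ofReal_mul_I_re, h₃, mul_comm]
  simp_rw [hl] at h
  rw [integral_comp_abs (f := fun x => gaussWeight δ x * Real.cos (a * x))] at h
  have hr : ((Real.pi : ℂ) / ((δ / 2 : ℝ) : ℂ)) ^ (1 / 2 : ℂ)
      * Complex.exp (-(a : ℂ) ^ 2 / (4 * ((δ / 2 : ℝ) : ℂ)))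
        = ((Real.sqrt (2 * Real.pi / δ) * Real.exp (-a ^ 2 / (2 * δ)) : ℝ) : ℂ) := by
    rw [Real.sqrt_eq_rpow, Complex.ofReal_mul, Complex.ofReal_cpow (by positivity)]
    push_cast
    congr 2
    · field_simp
    · congr 1
      have : (δ : ℂ) ≠ 0 := by exact_mod_cast hδ.ne'
      field_simp
      norm_num
  rw [hr, Complex.ofReal_re] at h
  linarith

theorem integrable_gaussWeight_mul_cos {δ : ℝ} (hδ : 0 < δ) (a : ℝ) :
    Integrable (fun y => gaussWeight δ y * Real.cos (a * y)) := by
  refine (integrable_gaussWeight hδ).mono' ?_ (ae_of_all _ fun y => ?_)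
  · have := measurable_gaussWeight δ
    exact (by fun_prop : Measurable fun y => gaussWeight δ y * Real.cos (a * y)).aestronglyMeasurable
  · rw [norm_mul, Real.norm_eq_abs, abs_of_pos (gaussWeight_pos δ y)]
    exact mul_le_of_le_one_right (gaussWeight_pos δ y).le (Real.abs_cos_le_one _)

theorem integrable_mul_gaussWeight_mul_sin {δ : ℝ} (hδ : 0 < δ) (a : ℝ) :
    Integrable (fun y => y * gaussWeight δ y * Real.sin (a * y)) := by
  refine (integrable_mul_gaussWeight hδ).norm.mono' ?_ (ae_of_all _ fun y => ?_)
  · have := measurable_gaussWeight δ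
    exact (by fun_prop :
      Measurable fun y => y * gaussWeight δ y * Real.sin (a * y)).aestronglyMeasurable
  · rw [norm_mul]
    exact mul_le_of_le_one_right (norm_nonneg _) (Real.abs_sin_le_one _)

/-- Sine-transform representation of the killed Brownian kernel. -/
theorem ptilde_eq_integral {δ : ℝ} (hδ : 0 < δ) (a b : ℝ) :
    ptilde δ a b = 2 / Real.pi *
      ∫ y in Set.Ioi (0 : ℝ), gaussWeight δ y * Real.sin (a * y) * Real.sin (b * y) := by
  have h : ∀ y : ℝ, gaussWeight δ y * Real.sin (a * y) * Real.sin (b * y)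
      = (gaussWeight δ y * Real.cos ((a - b) * y)
          - gaussWeight δ y * Real.cos ((a + b) * y)) / 2 := by
    intro y
    rw [sub_mul, add_mul, Real.cos_sub, Real.cos_add]
    ring
  simp_rw [h]
  rw [integral_div, integral_sub (integrable_gaussWeight_mul_cos hδ _).integrableOn
    (integrable_gaussWeight_mul_cos hδ _).integrableOn, integral_gaussWeight_mul_cos hδ,
    integral_gaussWeight_mul_cos hδ]
  have hs : Real.sqrt (2 * Real.pi / δ) = 2 * Real.pi * (Real.sqrt (2 * Real.pi * δ))⁻¹ := by
    have hp := Real.pi_pos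
    rw [← div_eq_mul_inv, eq_div_iff (by positivity), ← Real.sqrt_mul (by positivity),
      show 2 * Real.pi / δ * (2 * Real.pi * δ) = (2 * Real.pi) ^ 2 by field_simp,
      Real.sqrt_sq (by positivity)]
  rw [hs, ptilde]
  have hp := Real.pi_ne_zero
  field_simp

/-- Sine-transform representation of the meander entrance density. -/
theorem hexc_eq_integral {δ : ℝ} (hδ : 0 < δ) (x : ℝ) :
    hexc (1 - δ) x = 1 / Real.pi *
      ∫ y in Set.Ioi (0 : ℝ), y * gaussWeight δ y * Real.sin (x * y) := by
  have hI₁ := (integrable_mul_gaussWeight_mul_sin hδ x).integrableOn (s := Set.Ioi 0)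
  have hI₂ := (integrable_gaussWeight_mul_cos hδ x).integrableOn (s := Set.Ioi 0)
  have hlim : Filter.Tendsto (fun y => gaussWeight δ y * Real.sin (x * y)) Filter.atTop (nhds 0) := by
    have h₀ : Filter.Tendsto (gaussWeight δ) Filter.atTop (nhds 0) := by
      refine Real.tendsto_exp_atBot.comp ?_
      exact (Filter.tendsto_pow_atTop two_ne_zero).const_mul_atTop_of_neg (by linarith)
    refine squeeze_zero_norm (fun y => ?_) h₀
    rw [norm_mul, Real.norm_eq_abs, abs_of_pos (gaussWeight_pos δ y)]
    exact mul_le_of_le_one_right (gaussWeight_pos δ y).le (Real.abs_sin_le_one _)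
  have hd : ∀ y ∈ Set.Ici (0 : ℝ), HasDerivAt (fun y => gaussWeight δ y * Real.sin (x * y))
      (x * (gaussWeight δ y * Real.cos (x * y)) - δ * (y * gaussWeight δ y * Real.sin (x * y))) y := by
    intro y _
    have h₁ : HasDerivAt (gaussWeight δ) (gaussWeight δ y * (-(δ / 2) * (2 * y))) y := by
      have := ((hasDerivAt_pow 2 y).const_mul (-(δ / 2))).exp
      exact (show HasDerivAt (gaussWeight δ) _ y from this).congr_deriv (by simp [gaussWeight])
    have h₂ : HasDerivAt (fun y => Real.sin (x * y)) (Real.cos (x * y) * x) y := by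
      simpa using ((hasDerivAt_id y).const_mul x).sin
    exact (h₁.fun_mul h₂).congr_deriv (by ring)
  have h := integral_Ioi_of_hasDerivAt_of_tendsto' hd
    ((hI₂.const_mul x).sub (hI₁.const_mul δ)) hlim
  rw [integral_sub (hI₂.const_mul x) (hI₁.const_mul δ), integral_const_mul, integral_const_mul,
    integral_gaussWeight_mul_cos hδ] at h
  simp only [mul_zero, Real.sin_zero, sub_zero] at h
  have hI : ∫ y in Set.Ioi (0 : ℝ), y * gaussWeight δ y * Real.sin (x * y)
      = x / δ * (Real.sqrt (2 * Real.pi / δ) / 2 * Real.exp (-x ^ 2 / (2 * δ))) := by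
    rw [div_mul_eq_mul_div, eq_div_iff hδ.ne']
    linarith
  have hs : Real.sqrt (2 * Real.pi / δ) = 2 * Real.pi * δ / Real.sqrt (2 * Real.pi * δ ^ 3) := by
    have hp := Real.pi_pos
    rw [eq_div_iff (by positivity), ← Real.sqrt_mul (by positivity),
      show 2 * Real.pi / δ * (2 * Real.pi * δ ^ 3) = (2 * Real.pi * δ) ^ 2 by field_simp,
      Real.sqrt_sq (by positivity)]
  rw [hI, hs, hexc]
  have hp := Real.pi_ne_zero
  simp only [sub_sub_cancel]
  field_simp

theorem integral_exp_neg_mul_cos {c : ℝ} (hc : 0 < c) (a : ℝ) :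
    ∫ x in Set.Ioi (0 : ℝ), Real.exp (-(c * x)) * Real.cos (a * x) = c / (c ^ 2 + a ^ 2) := by
  have hre : (⟨-c, a⟩ : ℂ).re < 0 := by simpa using hc
  have h := integral_exp_mul_complex_Ioi hre 0
  have hr := integral_re (𝕜 := ℂ) (integrableOn_exp_mul_complex_Ioi hre 0)
  simp only [RCLike.re_to_complex] at hr
  rw [h] at hr
  simp only [Complex.exp_re, Complex.mul_re, Complex.mul_im, Complex.ofReal_re,
    Complex.ofReal_im] at hr
  convert hr using 1
  · simp
  · simp [Complex.div_re, Complex.normSq_apply]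
    ring

theorem integral_exp_neg_mul_sin {c : ℝ} (hc : 0 < c) (a : ℝ) :
    ∫ x in Set.Ioi (0 : ℝ), Real.exp (-(c * x)) * Real.sin (a * x) = a / (c ^ 2 + a ^ 2) := by
  have hre : (⟨-c, a⟩ : ℂ).re < 0 := by simpa using hc
  have h := integral_exp_mul_complex_Ioi hre 0
  have hr := integral_im (𝕜 := ℂ) (integrableOn_exp_mul_complex_Ioi hre 0)
  simp only [RCLike.im_to_complex] at hr
  rw [h] at hr
  simp only [Complex.exp_im, Complex.mul_re, Complex.mul_im, Complex.ofReal_re,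
    Complex.ofReal_im] at hr
  convert hr using 1
  · simp
  · simp [Complex.div_im, Complex.normSq_apply]
    ring

theorem integral_exp_neg_mul_sin_mul_sin {c : ℝ} (hc : 0 < c) (a b : ℝ) :
    ∫ x in Set.Ioi (0 : ℝ), Real.exp (-(c * x)) * Real.sin (a * x) * Real.sin (b * x)
      = cauchyKernel c a b / 2 := by
  have hint : ∀ d : ℝ, Integrable (fun x => Real.exp (-(c * x)) * Real.cos (d * x))
      (volume.restrict (Set.Ioi (0 : ℝ))) := fun d => by
    refine (integrableOn_exp_neg_mul hc).mono' (by fun_prop) (ae_of_all _ fun x => ?_)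
    rw [norm_mul, Real.norm_eq_abs, abs_of_pos (Real.exp_pos _)]
    exact mul_le_of_le_one_right (Real.exp_pos _).le (Real.abs_cos_le_one _)
  have h : ∀ x : ℝ, Real.exp (-(c * x)) * Real.sin (a * x) * Real.sin (b * x)
      = (Real.exp (-(c * x)) * Real.cos ((a - b) * x)
          - Real.exp (-(c * x)) * Real.cos ((a + b) * x)) / 2 := by
    intro x
    rw [sub_mul, add_mul, Real.cos_sub, Real.cos_add]
    ring
  simp_rw [h]
  rw [integral_div, integral_sub (hint _) (hint _), integral_exp_neg_mul_cos hc,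
    integral_exp_neg_mul_cos hc, cauchyKernel]

/-- Lebesgue measure on the positive half-line. -/
noncomputable abbrev posVol : Measure ℝ := volume.restrict (Set.Ioi (0 : ℝ))

theorem ae_posVol_pos : ∀ᵐ x ∂posVol, 0 < x := ae_restrict_mem measurableSet_Ioi

theorem integral_posVol_congr {f g : ℝ → ℝ} (h : ∀ x, 0 < x → f x = g x) :
    ∫ x, f x ∂posVol = ∫ x, g x ∂posVol :=
  integral_congr_ae (ae_posVol_pos.mono h)

theorem lintegral_posVol_congr {f g : ℝ → ENNReal} (h : ∀ x, 0 < x → f x = g x) :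
    ∫⁻ x, f x ∂posVol = ∫⁻ x, g x ∂posVol :=
  lintegral_congr_ae (ae_posVol_pos.mono h)

theorem integral_swap_of_le_mul {f : ℝ → ℝ → ℝ} (hf : Measurable (Function.uncurry f))
    {a b : ℝ → ℝ} (ha : Integrable a posVol) (hb : Integrable b posVol)
    (h : ∀ x, 0 < x → ∀ y, 0 < y → |f x y| ≤ a x * b y) :
    ∫ x, ∫ y, f x y ∂posVol ∂posVol = ∫ y, ∫ x, f x y ∂posVol ∂posVol := by
  refine integral_integral_swap ((ha.mul_prod hb).mono' hf.aestronglyMeasurable ?_)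
  rw [Measure.prod_restrict]
  filter_upwards [ae_restrict_mem (measurableSet_Ioi.prod measurableSet_Ioi)] with p hp
  exact h p.1 hp.1 p.2 hp.2

theorem abs_sin_mul_le {x y : ℝ} (hx : 0 < x) (hy : 0 < y) : |Real.sin (x * y)| ≤ x * y :=
  Real.abs_sin_le_abs.trans_eq (abs_of_pos (mul_pos hx hy))

/-- One step of the killed Brownian semigroup, with weight `exp(-c z)`. -/
noncomputable def killStep (c δ : ℝ) (G : ℝ → ℝ) (x : ℝ) : ℝ :=
  ∫ z, ptilde δ x z * (Real.exp (-(c * z)) * G z) ∂posVol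

/-- One step of the killed Cauchy semigroup, with weight `exp(-δ z² / 2)`. -/
noncomputable def cauchyStep (c δ : ℝ) (H : ℝ → ℝ) (y : ℝ) : ℝ :=
  ∫ z, cauchyKernel c y z / Real.pi * (gaussWeight δ z * H z) ∂posVol

/-- `G` is the sine transform of `H` with weight `exp(-δ y² / 2)`, both functions being
nonnegative on `(0, ∞)`, and `y H(y)` is bounded. -/
structure SineRep (δ : ℝ) (G H : ℝ → ℝ) : Prop where
  measurable_left : Measurable G
  measurable_right : Measurable H
  nonneg_left : ∀ x, 0 < x → 0 ≤ G x
  nonneg_right : ∀ y, 0 < y → 0 ≤ H y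
  bounded : ∃ C, ∀ y, 0 < y → y * H y ≤ C
  eq_integral : ∀ x, 0 < x →
    G x = 2 / Real.pi * ∫ y, gaussWeight δ y * Real.sin (x * y) * H y ∂posVol

theorem measurable_killStep {c δ : ℝ} {G : ℝ → ℝ} (hG : Measurable G) :
    Measurable (killStep c δ G) := by
  refine (StronglyMeasurable.integral_prod_right (f := fun x z =>
    ptilde δ x z * (Real.exp (-(c * z)) * G z)) ?_).measurable
  refine Measurable.stronglyMeasurable ?_
  exact (measurable_ptilde δ).mul (by fun_prop)

theorem measurable_cauchyStep {c δ : ℝ} {H : ℝ → ℝ} (hH : Measurable H) :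
    Measurable (cauchyStep c δ H) := by
  refine (StronglyMeasurable.integral_prod_right (f := fun y z =>
    cauchyKernel c y z / Real.pi * (gaussWeight δ z * H z)) ?_).measurable
  refine Measurable.stronglyMeasurable ?_
  have := measurable_gaussWeight δ
  exact ((measurable_cauchyKernel c).div_const _).mul (by fun_prop)

theorem killStep_nonneg {c δ : ℝ} {G : ℝ → ℝ} (hδ : 0 < δ) (hG : ∀ x, 0 < x → 0 ≤ G x)
    {x : ℝ} (hx : 0 < x) : 0 ≤ killStep c δ G x :=
  integral_nonneg_of_ae <| ae_posVol_pos.mono fun z hz =>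
    mul_nonneg (ptilde_nonneg hδ hx hz) (mul_nonneg (Real.exp_pos _).le (hG z hz))

theorem cauchyStep_nonneg {c δ : ℝ} {H : ℝ → ℝ} (hc : 0 < c) (hH : ∀ y, 0 < y → 0 ≤ H y)
    {y : ℝ} (hy : 0 < y) : 0 ≤ cauchyStep c δ H y :=
  integral_nonneg_of_ae <| ae_posVol_pos.mono fun z hz =>
    mul_nonneg (div_nonneg (cauchyKernel_nonneg hc hy hz) Real.pi_pos.le)
      (mul_nonneg (gaussWeight_pos _ _).le (hH z hz))

namespace SineRep

variable {δ : ℝ} {G H : ℝ → ℝ}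

theorem exists_left_le (h : SineRep δ G H) (hδ : 0 < δ) :
    ∃ C, 0 ≤ C ∧ ∀ x, 0 < x → G x ≤ C * x := by
  obtain ⟨C, hC⟩ := h.bounded
  have hC0 : 0 ≤ C := (mul_nonneg one_pos.le (h.nonneg_right 1 one_pos)).trans (hC 1 one_pos)
  have hgi : 0 ≤ ∫ y, gaussWeight δ y ∂posVol :=
    integral_nonneg fun y => (gaussWeight_pos δ y).le
  have hp := Real.pi_pos
  refine ⟨2 / Real.pi * ((∫ y, gaussWeight δ y ∂posVol) * C), by positivity, fun x hx => ?_⟩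
  rw [h.eq_integral x hx, mul_assoc, mul_assoc, ← integral_mul_const]
  refine mul_le_mul_of_nonneg_left ((Real.le_norm_self _).trans ?_) (by positivity)
  refine norm_integral_le_of_norm_le
    ((integrable_gaussWeight hδ).integrableOn.mul_const _) (ae_posVol_pos.mono fun y hy => ?_)
  have hH := h.nonneg_right y hy
  rw [Real.norm_eq_abs, abs_mul, abs_mul, abs_of_pos (gaussWeight_pos δ y), abs_of_nonneg hH,
    mul_assoc]
  refine mul_le_mul_of_nonneg_left ?_ (gaussWeight_pos δ y).le
  calc |Real.sin (x * y)| * H y ≤ x * y * H y :=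
        mul_le_mul_of_nonneg_right (abs_sin_mul_le hx hy) hH
    _ = (y * H y) * x := by ring
    _ ≤ C * x := mul_le_mul_of_nonneg_right (hC y hy) hx.le

theorem integral_exp_mul_sin_mul (h : SineRep δ G H) (hδ : 0 < δ) {c : ℝ} (hc : 0 < c)
    {y : ℝ} : ∫ x, Real.exp (-(c * x)) * Real.sin (y * x) * G x ∂posVol
      = cauchyStep c δ H y := by
  obtain ⟨C, hC⟩ := h.bounded
  have hmg := measurable_gaussWeight δ
  have hmH := h.measurable_right
  have hp := Real.pi_pos
  have hswap := integral_swap_of_le_mul (f := fun x z => 2 / Real.pi * (gaussWeight δ z * H z) *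
      (Real.exp (-(c * x)) * Real.sin (y * x) * Real.sin (z * x)))
    (by unfold Function.uncurry; fun_prop)
    (integrableOn_mul_exp_neg_mul hc)
    ((integrable_gaussWeight hδ).integrableOn.const_mul (2 / Real.pi * C)) (fun x hx z hz => by
      have hH := h.nonneg_right z hz
      have hg := gaussWeight_pos δ z
      have he := Real.exp_pos (-(c * x))
      rw [abs_mul, abs_of_nonneg (by positivity : 0 ≤ 2 / Real.pi * (gaussWeight δ z * H z)),
        abs_mul, abs_mul, abs_of_pos he]
      have h₁ : |Real.sin (y * x)| * |Real.sin (z * x)| ≤ 1 * (z * x) :=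
        mul_le_mul (Real.abs_sin_le_one _) (abs_sin_mul_le hz hx) (abs_nonneg _) one_pos.le
      calc 2 / Real.pi * (gaussWeight δ z * H z) *
            (Real.exp (-(c * x)) * |Real.sin (y * x)| * |Real.sin (z * x)|)
          = 2 / Real.pi * (gaussWeight δ z * H z) * Real.exp (-(c * x)) *
            (|Real.sin (y * x)| * |Real.sin (z * x)|) := by ring
        _ ≤ 2 / Real.pi * (gaussWeight δ z * H z) * Real.exp (-(c * x)) * (1 * (z * x)) := by
            gcongr
        _ = 2 / Real.pi * gaussWeight δ z * Real.exp (-(c * x)) * x * (z * H z) := by ring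
        _ ≤ 2 / Real.pi * gaussWeight δ z * Real.exp (-(c * x)) * x * C := by
            gcongr; exact hC z hz
        _ = _ := by ring)
  calc _ = ∫ x, ∫ z, 2 / Real.pi * (gaussWeight δ z * H z) *
      (Real.exp (-(c * x)) * Real.sin (y * x) * Real.sin (z * x)) ∂posVol ∂posVol := by
        refine integral_posVol_congr fun x hx => ?_
        rw [h.eq_integral x hx, ← integral_const_mul, ← integral_const_mul]
        refine integral_congr_ae (ae_of_all _ fun z => ?_)
        simp only [mul_comm x z]
        ring
    _ = _ := by
        rw [hswap]
        refine integral_posVol_congr fun z _ => ?_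
        rw [integral_const_mul, integral_exp_neg_mul_sin_mul_sin hc]
        ring

theorem integrable_cauchyStep (h : SineRep δ G H) (hδ : 0 < δ) {c : ℝ} (hc : 0 < c)
    {y : ℝ} (hy : 0 < y) :
    Integrable (fun z => cauchyKernel c y z / Real.pi * (gaussWeight δ z * H z)) posVol := by
  obtain ⟨C, hC⟩ := h.bounded
  have hmg := measurable_gaussWeight δ
  have hmH := h.measurable_right
  have hmK : Measurable (cauchyKernel c y) := by unfold cauchyKernel; fun_prop
  have hp := Real.pi_pos
  refine ((integrable_gaussWeight hδ).integrableOn.const_mul (4 / c / y / Real.pi * C)).mono'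
    (by fun_prop) (ae_posVol_pos.mono fun z hz => ?_)
  have hH := h.nonneg_right z hz
  have hg := gaussWeight_pos δ z
  have hK := cauchyKernel_nonneg hc hy hz
  rw [Real.norm_eq_abs, abs_of_nonneg (by positivity)]
  calc _ = gaussWeight δ z / Real.pi / y * H z * (y * cauchyKernel c y z) := by field_simp
    _ ≤ gaussWeight δ z / Real.pi / y * H z * (4 / c * z) := by
        exact mul_le_mul_of_nonneg_left (mul_cauchyKernel_le hc hy hz) (by positivity)
    _ = gaussWeight δ z / Real.pi / y * (4 / c) * (z * H z) := by ring
    _ ≤ gaussWeight δ z / Real.pi / y * (4 / c) * C := by gcongr; exact hC z hz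
    _ = _ := by ring

theorem mul_cauchyStep_le (h : SineRep δ G H) (hδ : 0 < δ) {c : ℝ} (hc : 0 < c) :
    ∃ C, ∀ y, 0 < y → y * cauchyStep c δ H y ≤ C := by
  obtain ⟨C, hC⟩ := h.bounded
  have hp := Real.pi_pos
  refine ⟨∫ z, 4 / c / Real.pi * C * gaussWeight δ z ∂posVol, fun y hy => ?_⟩
  rw [cauchyStep, ← integral_const_mul]
  refine integral_mono_ae ((h.integrable_cauchyStep hδ hc hy).const_mul y)
    ((integrable_gaussWeight hδ).integrableOn.const_mul _) (ae_posVol_pos.mono fun z hz => ?_)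
  have hH := h.nonneg_right z hz
  have hg := gaussWeight_pos δ z
  calc _ = gaussWeight δ z / Real.pi * H z * (y * cauchyKernel c y z) := by ring
    _ ≤ gaussWeight δ z / Real.pi * H z * (4 / c * z) := by
        exact mul_le_mul_of_nonneg_left (mul_cauchyKernel_le hc hy hz) (by positivity)
    _ = gaussWeight δ z / Real.pi * (4 / c) * (z * H z) := by ring
    _ ≤ gaussWeight δ z / Real.pi * (4 / c) * C := by gcongr; exact hC z hz
    _ = _ := by ring

/-- A pair in sine duality is mapped to such a pair by one step of the killed Brownian
semigroup on the left and of the killed Cauchy semigroup on the right. -/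
theorem step (h : SineRep δ G H) (hδ : 0 < δ) {c δ' : ℝ} (hc : 0 < c) (hδ' : 0 < δ') :
    SineRep δ' (killStep c δ' G) (cauchyStep c δ H) where
  measurable_left := measurable_killStep h.measurable_left
  measurable_right := measurable_cauchyStep h.measurable_right
  nonneg_left x hx := killStep_nonneg hδ' h.nonneg_left hx
  nonneg_right y hy := cauchyStep_nonneg hc h.nonneg_right hy
  bounded := h.mul_cauchyStep_le hδ hc
  eq_integral x hx := by
    obtain ⟨C, hC0, hC⟩ := h.exists_left_le hδ
    have hmg := measurable_gaussWeight δ'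
    have hmG := h.measurable_left
    have hp := Real.pi_pos
    have hswap := integral_swap_of_le_mul (f := fun z y =>
        2 / Real.pi * (gaussWeight δ' y * Real.sin (x * y)) *
        (Real.exp (-(c * z)) * Real.sin (y * z) * G z))
      (by unfold Function.uncurry; fun_prop)
      ((integrableOn_mul_exp_neg_mul hc).const_mul (2 / Real.pi * C))
      (integrable_gaussWeight hδ').integrableOn (fun z hz y hy => by
        have hG := h.nonneg_left z hz
        have hg := gaussWeight_pos δ' y
        have he := Real.exp_pos (-(c * z))
        rw [abs_mul, abs_mul, abs_mul, abs_mul, abs_mul, abs_of_pos he, abs_of_pos hg,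
          abs_of_nonneg hG, abs_of_pos (by positivity)]
        have h₁ := Real.abs_sin_le_one (x * y)
        have h₂ := Real.abs_sin_le_one (y * z)
        calc _ ≤ 2 / Real.pi * (gaussWeight δ' y * 1) * (Real.exp (-(c * z)) * 1 * (C * z)) := by
              gcongr; exact hC z hz
          _ = _ := by ring)
    calc _ = ∫ z, ∫ y, 2 / Real.pi * (gaussWeight δ' y * Real.sin (x * y)) *
        (Real.exp (-(c * z)) * Real.sin (y * z) * G z) ∂posVol ∂posVol := by
          refine integral_posVol_congr fun z hz => ?_
          rw [ptilde_eq_integral hδ', ← integral_const_mul, ← integral_mul_const]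
          refine integral_congr_ae (ae_of_all _ fun y => ?_)
          simp only [mul_comm z y]
          ring
      _ = _ := by
          rw [hswap, ← integral_const_mul]
          refine integral_posVol_congr fun y _ => ?_
          rw [integral_const_mul, h.integral_exp_mul_sin_mul hδ hc]
          ring

theorem lintegral_killStep (h : SineRep δ G H) (hδ : 0 < δ) {c δ' : ℝ} (hc : 0 < c)
    (hδ' : 0 < δ') {x : ℝ} (hx : 0 < x) :
    ∫⁻ z, ENNReal.ofReal (ptilde δ' x z) * ENNReal.ofReal (Real.exp (-(c * z)) * G z) ∂posVol
      = ENNReal.ofReal (killStep c δ' G x) := by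
  obtain ⟨C, hC0, hC⟩ := h.exists_left_le hδ
  have hmG := h.measurable_left
  have hmp : Measurable (ptilde δ' x) := by unfold ptilde; fun_prop
  rw [killStep, ofReal_integral_eq_lintegral_ofReal]
  · exact lintegral_posVol_congr fun z hz =>
      (ENNReal.ofReal_mul (ptilde_nonneg hδ' hx hz)).symm
  · refine ((integrableOn_mul_exp_neg_mul hc).const_mul
      ((Real.sqrt (2 * Real.pi * δ'))⁻¹ * C)).mono' (by fun_prop)
      (ae_posVol_pos.mono fun z hz => ?_)
    have hG := h.nonneg_left z hz
    have he := Real.exp_pos (-(c * z))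
    have hpt := ptilde_nonneg hδ' hx hz
    rw [Real.norm_eq_abs, abs_of_nonneg (by positivity)]
    calc _ ≤ (Real.sqrt (2 * Real.pi * δ'))⁻¹ * (Real.exp (-(c * z)) * (C * z)) := by
          gcongr
          · exact ptilde_le hδ' x z
          · exact hC z hz
      _ = _ := by ring
  · exact ae_posVol_pos.mono fun z hz => mul_nonneg (ptilde_nonneg hδ' hx hz)
      (mul_nonneg (Real.exp_pos _).le (h.nonneg_left z hz))

theorem lintegral_cauchyStep (h : SineRep δ G H) (hδ : 0 < δ) {c : ℝ} (hc : 0 < c)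
    {y : ℝ} (hy : 0 < y) :
    ∫⁻ z, ENNReal.ofReal (cauchyKernel c y z / Real.pi) *
        ENNReal.ofReal (gaussWeight δ z * H z) ∂posVol
      = ENNReal.ofReal (cauchyStep c δ H y) := by
  have hK : ∀ z, 0 < z → 0 ≤ cauchyKernel c y z / Real.pi := fun z hz =>
    div_nonneg (cauchyKernel_nonneg hc hy hz) Real.pi_pos.le
  rw [cauchyStep, ofReal_integral_eq_lintegral_ofReal (h.integrable_cauchyStep hδ hc hy)]
  · exact lintegral_posVol_congr fun z hz => (ENNReal.ofReal_mul (hK z hz)).symm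
  · exact ae_posVol_pos.mono fun z hz => mul_nonneg (hK z hz)
      (mul_nonneg (gaussWeight_pos _ _).le (h.nonneg_right z hz))

theorem lintegral_hexc (h : SineRep δ G H) (hδ : 0 < δ) {c δ' : ℝ} (hc : 0 < c)
    (hδ' : 0 < δ') :
    ∫⁻ x, ENNReal.ofReal (hexc (1 - δ') x) * ENNReal.ofReal (Real.exp (-(c * x)) * G x) ∂posVol
      = ENNReal.ofReal (1 / Real.pi) * ∫⁻ y, ENNReal.ofReal y *
          ENNReal.ofReal (gaussWeight δ' y * cauchyStep c δ H y) ∂posVol ∧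
    ∫⁻ x, ENNReal.ofReal (hexc (1 - δ') x) * ENNReal.ofReal (Real.exp (-(c * x)) * G x) ∂posVol
      ≠ ⊤ := by
  obtain ⟨C, hC0, hC⟩ := h.exists_left_le hδ
  obtain ⟨D, hD⟩ := h.mul_cauchyStep_le hδ hc
  have hmg := measurable_gaussWeight δ'
  have hmG := h.measurable_left
  have hmS := measurable_cauchyStep (c := c) (δ := δ) h.measurable_right
  have hmh : Measurable (hexc (1 - δ')) := by unfold hexc; fun_prop
  have hp := Real.pi_pos
  have hh : ∀ x, 0 < x → 0 ≤ hexc (1 - δ') x := fun x hx => by unfold hexc; positivity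
  have hS : ∀ y, 0 < y → 0 ≤ cauchyStep c δ H y := fun y hy =>
    cauchyStep_nonneg hc h.nonneg_right hy
  have hswap := integral_swap_of_le_mul (f := fun x y => 1 / Real.pi * (y * gaussWeight δ' y) *
      (Real.exp (-(c * x)) * Real.sin (y * x) * G x))
    (by unfold Function.uncurry; fun_prop)
    ((integrableOn_mul_exp_neg_mul hc).const_mul (1 / Real.pi * C))
    (integrable_mul_gaussWeight hδ').integrableOn (fun x hx y hy => by
      have hG := h.nonneg_left x hx
      have hg := gaussWeight_pos δ' y
      have he := Real.exp_pos (-(c * x))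
      rw [abs_mul, abs_of_nonneg (by positivity : 0 ≤ 1 / Real.pi * (y * gaussWeight δ' y)),
        abs_mul, abs_mul, abs_of_pos he, abs_of_nonneg hG]
      have h₂ := Real.abs_sin_le_one (y * x)
      calc _ ≤ 1 / Real.pi * (y * gaussWeight δ' y) * (Real.exp (-(c * x)) * 1 * (C * x)) := by
            gcongr; exact hC x hx
        _ = _ := by ring)
  have hI₁ : Integrable (fun x => hexc (1 - δ') x * (Real.exp (-(c * x)) * G x)) posVol := by
    refine ((integrableOn_mul_exp_neg_mul hc).const_mul
      (1 / Real.pi * (∫ y, y * gaussWeight δ' y ∂posVol) * C)).mono' (by fun_prop)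
      (ae_posVol_pos.mono fun x hx => ?_)
    have hG := h.nonneg_left x hx
    have he := Real.exp_pos (-(c * x))
    have hhx := hh x hx
    rw [Real.norm_eq_abs, abs_of_nonneg (by positivity)]
    have hle : hexc (1 - δ') x ≤ 1 / Real.pi * ∫ y, y * gaussWeight δ' y ∂posVol := by
      rw [hexc_eq_integral hδ']
      refine mul_le_mul_of_nonneg_left (integral_mono_ae
        (integrable_mul_gaussWeight_mul_sin hδ' x).integrableOn
        (integrable_mul_gaussWeight hδ').integrableOn (ae_posVol_pos.mono fun y hy => ?_))
        (by positivity)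
      exact mul_le_of_le_one_right (mul_pos hy (gaussWeight_pos δ' y)).le (Real.sin_le_one _)
    calc _ ≤ (1 / Real.pi * ∫ y, y * gaussWeight δ' y ∂posVol) *
          (Real.exp (-(c * x)) * (C * x)) := by
          have := hhx.trans hle
          gcongr
          exact hC x hx
      _ = _ := by ring
  have hI₂ : Integrable (fun y => y * (gaussWeight δ' y * cauchyStep c δ H y)) posVol := by
    refine ((integrable_gaussWeight hδ').integrableOn.const_mul D).mono' (by fun_prop)
      (ae_posVol_pos.mono fun y hy => ?_)
    have hg := gaussWeight_pos δ' y
    have hSy := hS y hy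
    rw [Real.norm_eq_abs, abs_of_nonneg (by positivity)]
    calc _ = gaussWeight δ' y * (y * cauchyStep c δ H y) := by ring
      _ ≤ gaussWeight δ' y * D := by gcongr; exact hD y hy
      _ = _ := by ring
  have heq : ∫ x, hexc (1 - δ') x * (Real.exp (-(c * x)) * G x) ∂posVol
      = 1 / Real.pi * ∫ y, y * (gaussWeight δ' y * cauchyStep c δ H y) ∂posVol := by
    calc _ = ∫ x, ∫ y, 1 / Real.pi * (y * gaussWeight δ' y) *
        (Real.exp (-(c * x)) * Real.sin (y * x) * G x) ∂posVol ∂posVol := by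
          refine integral_posVol_congr fun x hx => ?_
          rw [hexc_eq_integral hδ', ← integral_const_mul, ← integral_mul_const]
          refine integral_congr_ae (ae_of_all _ fun y => ?_)
          simp only [mul_comm x y]
          ring
      _ = _ := by
          rw [hswap, ← integral_const_mul]
          refine integral_posVol_congr fun y _ => ?_
          rw [integral_const_mul, h.integral_exp_mul_sin_mul hδ hc]
          ring
  have hl : ∫⁻ x, ENNReal.ofReal (hexc (1 - δ') x) *
      ENNReal.ofReal (Real.exp (-(c * x)) * G x) ∂posVol
        = ENNReal.ofReal (∫ x, hexc (1 - δ') x * (Real.exp (-(c * x)) * G x) ∂posVol) := by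
    rw [ofReal_integral_eq_lintegral_ofReal hI₁]
    · exact lintegral_posVol_congr fun x hx => (ENNReal.ofReal_mul (hh x hx)).symm
    · exact ae_posVol_pos.mono fun x hx => mul_nonneg (hh x hx)
        (mul_nonneg (Real.exp_pos _).le (h.nonneg_left x hx))
  refine ⟨?_, by rw [hl]; exact ENNReal.ofReal_ne_top⟩
  rw [hl, heq, ENNReal.ofReal_mul (by positivity), ofReal_integral_eq_lintegral_ofReal hI₂]
  · exact congrArg _ (lintegral_posVol_congr fun y hy => ENNReal.ofReal_mul hy.le)
  · exact ae_posVol_pos.mono fun y hy => mul_nonneg hy.le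
      (mul_nonneg (gaussWeight_pos _ _).le (hS y hy))

end SineRep

theorem integrable_ptilde_mul_exp {c δ : ℝ} (hc : 0 ≤ c) (hδ : 0 < δ) {x : ℝ} (hx : 0 < x) :
    Integrable (fun z => ptilde δ x z * (Real.exp (-(c * z)) * 1)) posVol := by
  have hg : ∀ a : ℝ, Integrable fun z => Real.exp (-(a + z) ^ 2 / (2 * δ)) := fun a => by
    have := (integrable_exp_neg_mul_sq (by positivity : 0 < 1 / (2 * δ))).comp_add_left a
    refine this.congr (ae_of_all _ fun z => ?_)
    simp only
    congr 1
    ring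
  have hpt : Integrable (ptilde δ x) posVol := by
    refine Integrable.integrableOn ?_
    refine Integrable.const_mul (((hg (-x)).congr (ae_of_all _ fun z => ?_)).sub (hg x)) _
    simp only
    congr 2
    ring
  refine hpt.mono' ?_ (ae_posVol_pos.mono fun z hz => ?_)
  · exact hpt.aestronglyMeasurable.mul (by fun_prop)
  · have hp := ptilde_nonneg hδ hx hz
    have he := Real.exp_pos (-(c * z))
    rw [mul_one, Real.norm_eq_abs, abs_of_nonneg (by positivity)]
    exact mul_le_of_le_one_right hp (Real.exp_le_one_iff.2 (by nlinarith))

theorem killStep_one_of_pos {c δ : ℝ} (hc : 0 < c) (hδ : 0 < δ) (x : ℝ) :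
    killStep c δ (fun _ => 1) x = 2 / Real.pi *
      ∫ y, gaussWeight δ y * Real.sin (x * y) * (y / (c ^ 2 + y ^ 2)) ∂posVol := by
  have hmg := measurable_gaussWeight δ
  have hp := Real.pi_pos
  have hswap := integral_swap_of_le_mul (f := fun z y =>
      2 / Real.pi * (gaussWeight δ y * Real.sin (x * y)) *
      (Real.exp (-(c * z)) * Real.sin (y * z)))
    (by unfold Function.uncurry; fun_prop)
    ((integrableOn_exp_neg_mul hc).const_mul (2 / Real.pi))
    (integrable_gaussWeight hδ).integrableOn (fun z _ y _ => by
      have hg := gaussWeight_pos δ y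
      have he := Real.exp_pos (-(c * z))
      rw [abs_mul, abs_mul, abs_mul, abs_mul, abs_of_pos he, abs_of_pos hg,
        abs_of_pos (by positivity)]
      have h₁ := Real.abs_sin_le_one (x * y)
      have h₂ := Real.abs_sin_le_one (y * z)
      calc _ ≤ 2 / Real.pi * (gaussWeight δ y * 1) * (Real.exp (-(c * z)) * 1) := by gcongr
        _ = _ := by ring)
  calc _ = ∫ z, ∫ y, 2 / Real.pi * (gaussWeight δ y * Real.sin (x * y)) *
      (Real.exp (-(c * z)) * Real.sin (y * z)) ∂posVol ∂posVol := by
        refine integral_posVol_congr fun z _ => ?_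
        rw [ptilde_eq_integral hδ, ← integral_const_mul, ← integral_mul_const]
        refine integral_congr_ae (ae_of_all _ fun y => ?_)
        simp only [mul_comm z y]
        ring
    _ = _ := by
        rw [hswap, ← integral_const_mul]
        refine integral_posVol_congr fun y _ => ?_
        rw [integral_const_mul, integral_exp_neg_mul_sin hc]
        ring

theorem killStep_zero_one {δ : ℝ} (hδ : 0 < δ) {x : ℝ} (hx : 0 < x) :
    killStep 0 δ (fun _ => 1) x = 2 / Real.pi *
      ∫ y, gaussWeight δ y * Real.sin (x * y) * (y / (0 ^ 2 + y ^ 2)) ∂posVol := by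
  have hmg := measurable_gaussWeight δ
  have hpos : ∀ᶠ c : ℝ in nhdsWithin 0 (Set.Ioi 0), 0 < c := eventually_mem_nhdsWithin
  have hid : Filter.Tendsto (fun c : ℝ => c) (nhdsWithin 0 (Set.Ioi 0)) (nhds 0) :=
    Filter.tendsto_id.mono_left nhdsWithin_le_nhds
  have h₁ : Filter.Tendsto (fun c => killStep c δ (fun _ => 1) x) (nhdsWithin 0 (Set.Ioi 0))
      (nhds (killStep 0 δ (fun _ => 1) x)) := by
    have hmp : Measurable (ptilde δ x) := by unfold ptilde; fun_prop
    refine tendsto_integral_filter_of_dominated_convergence _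
      (Filter.Eventually.of_forall fun c => by fun_prop) ?_
      (integrable_ptilde_mul_exp le_rfl hδ hx) (ae_of_all _ fun z => ?_)
    · filter_upwards [hpos] with c hc
      filter_upwards [ae_posVol_pos] with z hz
      have hp := ptilde_nonneg hδ hx hz
      have he := Real.exp_pos (-(c * z))
      rw [Real.norm_eq_abs, abs_of_nonneg (by positivity)]
      gcongr
    · exact (((hid.mul_const z).neg.rexp).mul_const 1).const_mul _
  have h₂ : Filter.Tendsto (fun c : ℝ => 2 / Real.pi *
      ∫ y, gaussWeight δ y * Real.sin (x * y) * (y / (c ^ 2 + y ^ 2)) ∂posVol)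
      (nhdsWithin 0 (Set.Ioi 0)) (nhds (2 / Real.pi *
      ∫ y, gaussWeight δ y * Real.sin (x * y) * (y / (0 ^ 2 + y ^ 2)) ∂posVol)) := by
    refine (tendsto_integral_filter_of_dominated_convergence (fun y => gaussWeight δ y * x)
      (Filter.Eventually.of_forall fun c => by fun_prop) ?_
      ((integrable_gaussWeight hδ).integrableOn.mul_const x)
      (ae_posVol_pos.mono fun y hy => ?_)).const_mul _
    · refine Filter.Eventually.of_forall fun c => ae_posVol_pos.mono fun y hy => ?_
      have hg := gaussWeight_pos δ y
      rw [norm_mul, norm_mul, Real.norm_eq_abs, abs_of_pos hg, mul_assoc]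
      refine mul_le_mul_of_nonneg_left ?_ hg.le
      have hq : ‖y / (c ^ 2 + y ^ 2)‖ ≤ 1 / y := by
        rw [Real.norm_eq_abs, abs_of_nonneg (by positivity), div_le_div_iff₀ (by positivity) hy]
        nlinarith [sq_nonneg c]
      calc _ ≤ (x * y) * (1 / y) :=
            mul_le_mul (abs_sin_mul_le hx hy) hq (norm_nonneg _) (by positivity)
        _ = x := by field_simp
    · refine Filter.Tendsto.const_mul _ (Filter.Tendsto.div tendsto_const_nhds
        ((hid.pow 2).add_const _) (by positivity))
  exact tendsto_nhds_unique (h₁.congr' (hpos.mono fun c hc => killStep_one_of_pos hc hδ x)) h₂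

/-- The sine duality for the last step. -/
theorem sineRep_killStep_one {c δ : ℝ} (hc : 0 ≤ c) (hδ : 0 < δ) :
    SineRep δ (killStep c δ fun _ => 1) (fun y => y / (c ^ 2 + y ^ 2)) where
  measurable_left := measurable_killStep measurable_const
  measurable_right := by fun_prop
  nonneg_left x hx := killStep_nonneg hδ (fun _ _ => zero_le_one) hx
  nonneg_right y hy := by positivity
  bounded := ⟨1, fun y hy => by
    rw [← mul_div_assoc, div_le_one (by positivity)]
    nlinarith [sq_nonneg c]⟩
  eq_integral x hx := by
    rcases hc.eq_or_lt with rfl | hc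
    · exact killStep_zero_one hδ hx
    · exact killStep_one_of_pos hc hδ x

theorem lintegral_killStep_one {c δ : ℝ} (hc : 0 ≤ c) (hδ : 0 < δ) {x : ℝ} (hx : 0 < x) :
    ∫⁻ z, ENNReal.ofReal (ptilde δ x z) * ENNReal.ofReal (Real.exp (-(c * z))) ∂posVol
      = ENNReal.ofReal (killStep c δ (fun _ => 1) x) := by
  rw [killStep, ofReal_integral_eq_lintegral_ofReal (integrable_ptilde_mul_exp hc hδ hx)]
  · refine lintegral_posVol_congr fun z hz => ?_
    rw [mul_one, ENNReal.ofReal_mul (ptilde_nonneg hδ hx hz)]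
  · exact ae_posVol_pos.mono fun z hz => mul_nonneg (ptilde_nonneg hδ hx hz)
      (mul_nonneg (Real.exp_pos _).le zero_le_one)

/-- The integral of a Markov-type product of kernels over `(0, ∞)^(m+1)`. -/
noncomputable def chainIntegral (m : ℕ) (f : ℝ → ENNReal) (w : ℕ → ℝ → ℝ → ENNReal)
    (g : ℝ → ENNReal) : ENNReal :=
  ∫⁻ x : Fin (m + 1) → ℝ, f (x 0) * (∏ k : Fin m, w k (x k.castSucc) (x k.succ)) *
    g (x (Fin.last m)) ∂Measure.pi fun _ => posVol

theorem ae_pi_posVol_pos (m : ℕ) :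
    ∀ᵐ x : Fin m → ℝ ∂Measure.pi fun _ => posVol, ∀ i, 0 < x i :=
  ae_all_iff.2 fun _ => Measure.tendsto_eval_ae_ae.eventually ae_posVol_pos

theorem chainIntegral_congr {m : ℕ} {f : ℝ → ENNReal} {w : ℕ → ℝ → ℝ → ENNReal}
    {g g' : ℝ → ENNReal} (h : ∀ x, 0 < x → g x = g' x) :
    chainIntegral m f w g = chainIntegral m f w g' :=
  lintegral_congr_ae <| (ae_pi_posVol_pos (m + 1)).mono fun x hx => by
    simp only [h _ (hx (Fin.last m))]

theorem chainIntegral_zero (f : ℝ → ENNReal) (w : ℕ → ℝ → ℝ → ENNReal) (g : ℝ → ENNReal) :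
    chainIntegral 0 f w g = ∫⁻ x, f x * g x ∂posVol := by
  have := (measurePreserving_piUnique (fun _ : Fin 1 => posVol)).lintegral_comp_emb
    (MeasurableEquiv.measurableEmbedding _) (fun x => f x * g x)
  simp only [chainIntegral, Finset.univ_eq_empty, Finset.prod_empty, mul_one]
  exact this

/-- Integrating out the last coordinate. -/
theorem chainIntegral_succ {m : ℕ} {f : ℝ → ENNReal} {w : ℕ → ℝ → ℝ → ENNReal}
    {g : ℝ → ENNReal} (hf : Measurable f) (hw : ∀ k, Measurable (Function.uncurry (w k)))
    (hg : Measurable g) :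
    chainIntegral (m + 1) f w g
      = chainIntegral m f w (fun x => ∫⁻ z, w m x z * g z ∂posVol) := by
  have hprod : Measurable fun x : Fin (m + 1) → ℝ =>
      ∏ k : Fin m, w k (x k.castSucc) (x k.succ) :=
    Finset.measurable_fun_prod _ fun k _ => by
      have hk : Measurable fun x : Fin (m + 1) → ℝ => (x k.castSucc, x k.succ) := by fun_prop
      exact (hw k).comp hk
  have hlast : Measurable fun p : ℝ × (Fin (m + 1) → ℝ) => w m (p.2 (Fin.last m)) p.1 * g p.1 := by
    have hk : Measurable fun p : ℝ × (Fin (m + 1) → ℝ) => (p.2 (Fin.last m), p.1) := by fun_prop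
    exact ((hw m).comp hk).mul (hg.comp measurable_fst)
  have hF : Measurable fun p : ℝ × (Fin (m + 1) → ℝ) =>
      f (p.2 0) * (∏ k : Fin m, w k (p.2 k.castSucc) (p.2 k.succ)) *
        (w m (p.2 (Fin.last m)) p.1 * g p.1) := by
    have h₀ : Measurable fun p : ℝ × (Fin (m + 1) → ℝ) => f (p.2 0) := by fun_prop
    exact (h₀.mul (hprod.comp measurable_snd)).mul hlast
  have hmp := measurePreserving_piFinSuccAbove (fun _ : Fin (m + 2) => posVol) (Fin.last (m + 1))
  have h := hmp.lintegral_comp hF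
  calc chainIntegral (m + 1) f w g = _ := ?_
    _ = _ := h
    _ = _ := ?_
  · refine lintegral_congr fun x => ?_
    have he : MeasurableEquiv.piFinSuccAbove (fun _ => ℝ) (Fin.last (m + 1)) x
        = (x (Fin.last (m + 1)), fun j => x j.castSucc) := by
      refine Prod.ext rfl (funext fun j => ?_)
      change x ((Fin.last (m + 1)).succAbove j) = _
      rw [Fin.succAbove_last]
    rw [he, Fin.prod_univ_castSucc]
    simp only [Fin.castSucc_zero, Fin.val_castSucc, Fin.val_last, Fin.succ_last,
      Fin.succ_castSucc]
    ring
  · rw [lintegral_prod_symm _ hF.aemeasurable]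
    refine lintegral_congr fun x => ?_
    have hx : Measurable fun z : ℝ => w m (x (Fin.last m)) z * g z :=
      hlast.comp (measurable_id.prodMk (measurable_const (a := x)))
    dsimp only
    rw [lintegral_const_mul _ hx]

/-- Duality between chains of killed Brownian kernels and chains of killed Cauchy kernels. -/
theorem chainIntegral_duality {n : ℕ} {s c : ℕ → ℝ} (hs : ∀ k ≤ n, s k < s (k + 1))
    (hc : ∀ k, 1 ≤ k → k ≤ n → 0 < c k) (m : ℕ) (hm : m + 1 ≤ n) {G H : ℝ → ℝ}
    (h : SineRep (s (m + 2) - s (m + 1)) G H) :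
    chainIntegral m (fun x => ENNReal.ofReal (hexc (1 - (s 1 - s 0)) x))
        (fun k x z => ENNReal.ofReal (Real.exp (-(c (k + 1) * x)) *
          ptilde (s (k + 2) - s (k + 1)) x z))
        (fun x => ENNReal.ofReal (Real.exp (-(c (m + 1) * x)) * G x))
      = ENNReal.ofReal (1 / Real.pi) * chainIntegral (m + 1) (fun y => ENNReal.ofReal y)
        (fun k y z => ENNReal.ofReal (gaussWeight (s (k + 1) - s k) y *
          (cauchyKernel (c (k + 1)) y z / Real.pi)))
        (fun y => ENNReal.ofReal (gaussWeight (s (m + 2) - s (m + 1)) y * H y)) ∧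
    chainIntegral m (fun x => ENNReal.ofReal (hexc (1 - (s 1 - s 0)) x))
        (fun k x z => ENNReal.ofReal (Real.exp (-(c (k + 1) * x)) *
          ptilde (s (k + 2) - s (k + 1)) x z))
        (fun x => ENNReal.ofReal (Real.exp (-(c (m + 1) * x)) * G x)) ≠ ⊤ := by
  have hmh : Measurable fun x => ENNReal.ofReal (hexc (1 - (s 1 - s 0)) x) := by
    unfold hexc; fun_prop
  have hmw : ∀ k, Measurable (Function.uncurry fun x z => ENNReal.ofReal
      (Real.exp (-(c (k + 1) * x)) * ptilde (s (k + 2) - s (k + 1)) x z)) := fun k =>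
    ((by fun_prop : Measurable fun p : ℝ × ℝ => Real.exp (-(c (k + 1) * p.1))).mul
      (measurable_ptilde _)).ennreal_ofReal
  have hmw' : ∀ k, Measurable (Function.uncurry fun y z => ENNReal.ofReal
      (gaussWeight (s (k + 1) - s k) y * (cauchyKernel (c (k + 1)) y z / Real.pi))) := fun k =>
    (((measurable_gaussWeight _).comp measurable_fst).mul
      ((measurable_cauchyKernel _).div_const _)).ennreal_ofReal
  -- one step on the Cauchy side
  have hcauchy : ∀ (k : ℕ) (G H : ℝ → ℝ), k + 1 ≤ n → SineRep (s (k + 2) - s (k + 1)) G H →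
      chainIntegral (k + 1) (fun y => ENNReal.ofReal y)
        (fun k y z => ENNReal.ofReal (gaussWeight (s (k + 1) - s k) y *
          (cauchyKernel (c (k + 1)) y z / Real.pi)))
        (fun y => ENNReal.ofReal (gaussWeight (s (k + 2) - s (k + 1)) y * H y))
      = chainIntegral k (fun y => ENNReal.ofReal y)
        (fun k y z => ENNReal.ofReal (gaussWeight (s (k + 1) - s k) y *
          (cauchyKernel (c (k + 1)) y z / Real.pi)))
        (fun y => ENNReal.ofReal (gaussWeight (s (k + 1) - s k) y *
          cauchyStep (c (k + 1)) (s (k + 2) - s (k + 1)) H y)) := by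
    intro k G H hk h
    have hmH := h.measurable_right
    have hmg := measurable_gaussWeight (s (k + 2) - s (k + 1))
    rw [chainIntegral_succ (f := fun y => ENNReal.ofReal y) (by fun_prop) hmw' (by fun_prop)]
    refine chainIntegral_congr fun y hy => ?_
    simp only [ENNReal.ofReal_mul (gaussWeight_pos (s (k + 1) - s k) y).le, mul_assoc]
    rw [lintegral_const_mul' _ _ ENNReal.ofReal_ne_top,
      h.lintegral_cauchyStep (sub_pos.2 (hs (k + 1) hk)) (hc _ (by omega) hk) hy]
  induction m generalizing G H with
  | zero =>
    have hδ := sub_pos.2 (hs 1 hm)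
    rw [hcauchy 0 G H hm h, chainIntegral_zero, chainIntegral_zero]
    exact h.lintegral_hexc hδ (hc 1 le_rfl hm) (sub_pos.2 (hs 0 (by omega)))
  | succ m ih =>
    have hδ := sub_pos.2 (hs (m + 2) hm)
    have hδ' := sub_pos.2 (hs (m + 1) (by omega))
    have hcm := hc (m + 2) (by omega) hm
    have hmG := h.measurable_left
    rw [hcauchy (m + 1) G H hm h, chainIntegral_succ hmh hmw (by fun_prop),
      chainIntegral_congr (g' := fun x => ENNReal.ofReal (Real.exp (-(c (m + 1) * x)) *
        killStep (c (m + 2)) (s (m + 2) - s (m + 1)) G x)) fun x hx => ?_]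
    · exact ih (by omega) (h.step hδ hcm hδ')
    · simp only [ENNReal.ofReal_mul (Real.exp_pos (-(c (m + 1) * x))).le, mul_assoc]
      rw [lintegral_const_mul' _ _ ENNReal.ofReal_ne_top, h.lintegral_killStep hδ hcm hδ' hx]

theorem chainIntegral_duality_one {m : ℕ} {s c : ℕ → ℝ} (hs : ∀ k ≤ m + 1, s k < s (k + 1))
    (hc : ∀ k, 1 ≤ k → k ≤ m + 1 → 0 < c k) (hcm : 0 ≤ c (m + 2)) :
    chainIntegral (m + 1) (fun x => ENNReal.ofReal (hexc (1 - (s 1 - s 0)) x))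
        (fun k x z => ENNReal.ofReal (Real.exp (-(c (k + 1) * x)) *
          ptilde (s (k + 2) - s (k + 1)) x z))
        (fun x => ENNReal.ofReal (Real.exp (-(c (m + 2) * x))))
      = ENNReal.ofReal (1 / Real.pi) * chainIntegral (m + 1) (fun y => ENNReal.ofReal y)
        (fun k y z => ENNReal.ofReal (gaussWeight (s (k + 1) - s k) y *
          (cauchyKernel (c (k + 1)) y z / Real.pi)))
        (fun y => ENNReal.ofReal (gaussWeight (s (m + 2) - s (m + 1)) y *
          (y / (c (m + 2) ^ 2 + y ^ 2)))) ∧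
    chainIntegral (m + 1) (fun x => ENNReal.ofReal (hexc (1 - (s 1 - s 0)) x))
        (fun k x z => ENNReal.ofReal (Real.exp (-(c (k + 1) * x)) *
          ptilde (s (k + 2) - s (k + 1)) x z))
        (fun x => ENNReal.ofReal (Real.exp (-(c (m + 2) * x)))) ≠ ⊤ := by
  have hδ := sub_pos.2 (hs (m + 1) le_rfl)
  have hmh : Measurable fun x => ENNReal.ofReal (hexc (1 - (s 1 - s 0)) x) := by
    unfold hexc; fun_prop
  have hmw : ∀ k, Measurable (Function.uncurry fun x z => ENNReal.ofReal
      (Real.exp (-(c (k + 1) * x)) * ptilde (s (k + 2) - s (k + 1)) x z)) := fun k =>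
    ((by fun_prop : Measurable fun p : ℝ × ℝ => Real.exp (-(c (k + 1) * p.1))).mul
      (measurable_ptilde _)).ennreal_ofReal
  rw [chainIntegral_succ hmh hmw (by fun_prop),
    chainIntegral_congr (g' := fun x => ENNReal.ofReal (Real.exp (-(c (m + 1) * x)) *
      killStep (c (m + 2)) (s (m + 2) - s (m + 1)) (fun _ => 1) x)) fun x hx => ?_]
  · exact chainIntegral_duality hs hc m le_rfl (sineRep_killStep_one hcm hδ)
  · simp only [ENNReal.ofReal_mul (Real.exp_pos (-(c (m + 1) * x))).le, mul_assoc]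
    rw [lintegral_const_mul' _ _ ENNReal.ofReal_ne_top, lintegral_killStep_one hcm hδ hx]

theorem ext_pos {m : ℕ} {x : Fin m → ℝ} (hx : ∀ i, 0 < x i) {k : ℕ} (hk : k < m) :
    0 < ext m x k := by
  simp [ext, hk, hx]

theorem integrable_chain {m : ℕ} {f g : ℝ → ℝ} {w : ℕ → ℝ → ℝ → ℝ} (hf : Measurable f)
    (hw : ∀ k, Measurable (Function.uncurry (w k))) (hg : Measurable g)
    (hf0 : ∀ x, 0 < x → 0 ≤ f x) (hw0 : ∀ k < m, ∀ x, 0 < x → ∀ z, 0 < z → 0 ≤ w k x z)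
    (hg0 : ∀ x, 0 < x → 0 ≤ g x)
    (h : chainIntegral m (fun x => ENNReal.ofReal (f x)) (fun k x z => ENNReal.ofReal (w k x z))
      (fun x => ENNReal.ofReal (g x)) ≠ ⊤) :
    Integrable (fun x : Fin (m + 1) → ℝ => f (ext (m + 1) x 0) *
      (∏ k ∈ Finset.range m, w k (ext (m + 1) x k) (ext (m + 1) x (k + 1))) *
      g (ext (m + 1) x m)) (Measure.pi fun _ => posVol) ∧
    ∫ x : Fin (m + 1) → ℝ, f (ext (m + 1) x 0) *
      (∏ k ∈ Finset.range m, w k (ext (m + 1) x k) (ext (m + 1) x (k + 1))) *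
      g (ext (m + 1) x m) ∂(Measure.pi fun _ => posVol)
    = (chainIntegral m (fun x => ENNReal.ofReal (f x)) (fun k x z => ENNReal.ofReal (w k x z))
      (fun x => ENNReal.ofReal (g x))).toReal := by
  have hext : ∀ k, Measurable fun x : Fin (m + 1) → ℝ => ext (m + 1) x k := fun k => by
    unfold ext
    split_ifs <;> fun_prop
  set F : (Fin (m + 1) → ℝ) → ℝ := fun x => f (ext (m + 1) x 0) *
      (∏ k ∈ Finset.range m, w k (ext (m + 1) x k) (ext (m + 1) x (k + 1))) *
      g (ext (m + 1) x m) with hF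
  have hmF : Measurable F := by
    refine ((hf.comp (hext 0)).mul (Finset.measurable_fun_prod _ fun k _ => ?_)).mul
      (hg.comp (hext m))
    exact (hw k).comp ((hext k).prodMk (hext (k + 1)))
  have hnn : ∀ x : Fin (m + 1) → ℝ, (∀ i, 0 < x i) → ∀ k ∈ Finset.range m,
      0 ≤ w k (ext (m + 1) x k) (ext (m + 1) x (k + 1)) := fun x hx k hk => by
    have hk := Finset.mem_range.1 hk
    exact hw0 k hk _ (ext_pos hx (by omega)) _ (ext_pos hx (by omega))
  have hF0 : 0 ≤ᵐ[Measure.pi fun _ => posVol] F :=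
    (ae_pi_posVol_pos (m + 1)).mono fun x hx => mul_nonneg (mul_nonneg
      (hf0 _ (ext_pos hx (by omega))) (Finset.prod_nonneg (hnn x hx)))
      (hg0 _ (ext_pos hx (by omega)))
  have hl : ∫⁻ x, ENNReal.ofReal (F x) ∂(Measure.pi fun _ => posVol)
      = chainIntegral m (fun x => ENNReal.ofReal (f x))
        (fun k x z => ENNReal.ofReal (w k x z)) (fun x => ENNReal.ofReal (g x)) := by
    refine lintegral_congr_ae ((ae_pi_posVol_pos (m + 1)).mono fun x hx => ?_)
    simp only [hF]
    rw [ENNReal.ofReal_mul (mul_nonneg (hf0 _ (ext_pos hx (by omega)))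
      (Finset.prod_nonneg (hnn x hx))), ENNReal.ofReal_mul (hf0 _ (ext_pos hx (by omega))),
      ENNReal.ofReal_prod_of_nonneg (hnn x hx), Finset.prod_range]
    have h₁ : ∀ k : Fin m, ext (m + 1) x k = x k.castSucc := fun k => by
      simp [ext, Fin.castSucc, Fin.castAdd, Fin.castLE, k.2.trans (Nat.lt_succ_self m)]
    have h₂ : ∀ k : Fin m, ext (m + 1) x (k + 1) = x k.succ := fun k => by
      simp [ext, Fin.succ]
    have h₃ : ext (m + 1) x 0 = x 0 := by simp [ext]
    have h₄ : ext (m + 1) x m = x (Fin.last m) := by simp [ext, Fin.last]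
    simp only [h₁, h₂, h₃, h₄]
  refine ⟨⟨hmF.aestronglyMeasurable, ?_⟩, ?_⟩
  · rw [hasFiniteIntegral_iff_ofReal hF0, hl]
    exact lt_top_iff_ne_top.2 h
  · rw [integral_eq_lintegral_of_nonneg_ae hF0 hmF.aestronglyMeasurable, hl]

theorem mul_prod_div_telescope {a : ℕ → ℝ} {m : ℕ} (ha : ∀ k ≤ m, a k ≠ 0) :
    a 0 * ∏ k ∈ Finset.range m, a (k + 1) / a k = a m := by
  induction m with
  | zero => simp
  | succ m ih =>
    rw [Finset.prod_range_succ, ← mul_assoc, ih fun k hk => ha k (by omega),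
      mul_div_cancel₀ _ (ha m (by omega))]

theorem htil_pos {s x : ℝ} (hs : s < 1) (hx : 0 < x) : 0 < htil s x := by
  unfold htil
  have h1 : 0 < 1 - s := sub_pos.2 hs
  have hp := Real.pi_pos
  refine mul_pos (by positivity) (intervalIntegral.intervalIntegral_pos_of_pos ?_
    (fun u => Real.exp_pos _) hx)
  exact (by fun_prop : Continuous fun u : ℝ =>
    Real.exp (-u ^ 2 / (2 * (1 - s)))).intervalIntegrable _ _

/-- The factors `h̃` cancel in the joint density of the meander. -/
theorem meander_density_eq {m : ℕ} {s c X : ℕ → ℝ} (hs0 : s 0 = 0) (hs1 : s (m + 2) = 1)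
    (hs : ∀ k ≤ m + 1, s k < s (k + 1)) (hX : ∀ k < m + 2, 0 < X k) :
    Real.exp (-(∑ k ∈ Finset.range (m + 2), c (k + 1) * X k)) *
          (Real.sqrt (8 * Real.pi) * hexc (1 - s 1) (X 0) * htil (s 1) (X 0)) *
          (∏ k ∈ Finset.range m,
            (htil (s (k + 2)) (X (k + 1)) / htil (s (k + 1)) (X k)) *
              ptilde (s (k + 2) - s (k + 1)) (X k) (X (k + 1))) *
          (ptilde (1 - s (m + 1)) (X m) (X (m + 1)) / (2 * htil (s (m + 1)) (X m)))
      = Real.sqrt (2 * Real.pi) * (hexc (1 - (s 1 - s 0)) (X 0) *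
        (∏ k ∈ Finset.range (m + 1), Real.exp (-(c (k + 1) * X k)) *
          ptilde (s (k + 2) - s (k + 1)) (X k) (X (k + 1))) *
        Real.exp (-(c (m + 2) * X (m + 1)))) := by
  have hlt : ∀ j ≤ m + 1, s (m + 1 - j) < 1 := by
    intro j hj
    induction j with
    | zero => simpa [hs1] using hs (m + 1) le_rfl
    | succ j ih =>
      have h₁ := hs (m + 1 - (j + 1)) (by omega)
      rw [show m + 1 - (j + 1) + 1 = m + 1 - j by omega] at h₁
      exact h₁.trans (ih (by omega))
  have ha : ∀ k ≤ m, htil (s (k + 1)) (X k) ≠ 0 := fun k hk => by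
    have := hlt (m - k) (by omega)
    rw [show m + 1 - (m - k) = k + 1 by omega] at this
    exact (htil_pos this (hX k (by omega))).ne'
  have htel := mul_prod_div_telescope (a := fun k => htil (s (k + 1)) (X k)) ha
  have h8 : Real.sqrt (8 * Real.pi) = 2 * Real.sqrt (2 * Real.pi) := by
    rw [show 8 * Real.pi = 2 ^ 2 * (2 * Real.pi) by ring, Real.sqrt_mul (by norm_num),
      Real.sqrt_sq (by norm_num)]
  have hm := ha m le_rfl
  rw [← Finset.sum_neg_distrib, Real.exp_sum, Finset.prod_range_succ _ (m + 1),
    Finset.prod_mul_distrib, Finset.prod_mul_distrib, Finset.prod_range_succ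
      (fun k => ptilde (s (k + 2) - s (k + 1)) (X k) (X (k + 1))), hs1, hs0, sub_zero, h8]
  simp only [zero_add] at htel
  calc _ = (∏ x ∈ Finset.range (m + 1), Real.exp (-(c (x + 1) * X x))) *
        Real.exp (-(c (m + 2) * X (m + 1))) * Real.sqrt (2 * Real.pi) * hexc (1 - s 1) (X 0) *
        (∏ k ∈ Finset.range m, ptilde (s (k + 2) - s (k + 1)) (X k) (X (k + 1))) *
        ptilde (1 - s (m + 1)) (X m) (X (m + 1)) *
        ((htil (s 1) (X 0) * ∏ k ∈ Finset.range m,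
          htil (s (k + 1 + 1)) (X (k + 1)) / htil (s (k + 1)) (X k)) /
            htil (s (m + 1)) (X m)) := by
        field_simp
    _ = _ := by
        rw [htel, div_self hm]
        ring

theorem cauchy_density_eq {n : ℕ} {s c t Y : ℕ → ℝ}
    (ht : ∀ k, t k = ∑ j ∈ Finset.range k, c (j + 1)) (hY : ∀ k < n + 1, 0 < Y k) :
    Real.exp (-(1 / 2) * ∑ k ∈ Finset.range (n + 1), (s (k + 1) - s k) * (Y k) ^ 2) *
          (c (n + 1) ^ 2 + (Y n) ^ 2)⁻¹ *
          (∏ k ∈ Finset.range n, qrad (t (k + 1) - t k) (Y k) (Y (k + 1))) * (Y 0) ^ 2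
      = Y 0 * (∏ k ∈ Finset.range n, gaussWeight (s (k + 1) - s k) (Y k) *
          (cauchyKernel (c (k + 1)) (Y k) (Y (k + 1)) / Real.pi)) *
        (gaussWeight (s (n + 1) - s n) (Y n) * (Y n / (c (n + 1) ^ 2 + Y n ^ 2))) := by
  have hq : ∀ k, qrad (t (k + 1) - t k) (Y k) (Y (k + 1))
      = Y (k + 1) / Y k * (cauchyKernel (c (k + 1)) (Y k) (Y (k + 1)) / Real.pi) := fun k => by
    rw [ht, ht, Finset.sum_range_succ, add_sub_cancel_left, qrad, cauchyKernel]
    ring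
  have hg : Real.exp (-(1 / 2) * ∑ k ∈ Finset.range (n + 1), (s (k + 1) - s k) * (Y k) ^ 2)
      = ∏ k ∈ Finset.range (n + 1), gaussWeight (s (k + 1) - s k) (Y k) := by
    rw [Finset.mul_sum, Real.exp_sum]
    refine Finset.prod_congr rfl fun k _ => ?_
    rw [gaussWeight]
    congr 1
    ring
  have htel := mul_prod_div_telescope (a := Y) (m := n) fun k hk => (hY k (by omega)).ne'
  simp only [hq]
  rw [hg, Finset.prod_range_succ, Finset.prod_mul_distrib, Finset.prod_mul_distrib]
  linear_combination (∏ k ∈ Finset.range n, gaussWeight (s (k + 1) - s k) (Y k)) *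
    gaussWeight (s (n + 1) - s n) (Y n) * (c (n + 1) ^ 2 + Y n ^ 2)⁻¹ *
    (∏ k ∈ Finset.range n, cauchyKernel (c (k + 1)) (Y k) (Y (k + 1)) / Real.pi) * Y 0 * htel

/-- Dual representation of the Laplace transform of the Brownian meander including its
endpoint: `E[exp(−Σ_{k=1}^{n+1} cₖ B^{me}_{s̃ₖ})]` (with `s̃_{n+1}=1`) equals
`√(2/π)∫ E[exp(−½Σ(s̃ₖ₊₁−s̃ₖ)Y²_{tₖ})(c_{n+1}²+Y²_{tₙ})⁻¹ | Y₀=y] y² dy`, written out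
via the joint densities. Here `x 0, …, x n` play the roles of `x₁, …, x_{n+1}` and
`y 0, …, y n` of `y₀, …, yₙ`. -/
theorem statement5 (n : ℕ) (hn : 1 ≤ n) (s : ℕ → ℝ) (c : ℕ → ℝ) (t : ℕ → ℝ)
    (hs0 : s 0 = 0) (hs1 : s (n + 1) = 1) (hsmono : ∀ k ≤ n, s k < s (k + 1))
    (hc : ∀ k, 1 ≤ k → k ≤ n → 0 < c k) (hcn : 0 ≤ c (n + 1))
    (ht : ∀ k, t k = ∑ j ∈ Finset.range k, c (j + 1)) :
    Integrable
      (fun x : Fin (n + 1) → ℝ =>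
        Real.exp (-(∑ k ∈ Finset.range (n + 1), c (k + 1) * ext (n + 1) x k)) *
          (Real.sqrt (8 * Real.pi) * hexc (1 - s 1) (ext (n + 1) x 0) *
            htil (s 1) (ext (n + 1) x 0)) *
          (∏ k ∈ Finset.range (n - 1),
            (htil (s (k + 2)) (ext (n + 1) x (k + 1)) / htil (s (k + 1)) (ext (n + 1) x k)) *
              ptilde (s (k + 2) - s (k + 1)) (ext (n + 1) x k) (ext (n + 1) x (k + 1))) *
          (ptilde (1 - s n) (ext (n + 1) x (n - 1)) (ext (n + 1) x n) /
            (2 * htil (s n) (ext (n + 1) x (n - 1)))))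
      (Measure.pi fun _ : Fin (n + 1) => volume.restrict (Set.Ioi (0 : ℝ))) ∧
    Integrable
      (fun y : Fin (n + 1) → ℝ =>
        Real.exp (-(1 / 2) * ∑ k ∈ Finset.range (n + 1),
            (s (k + 1) - s k) * (ext (n + 1) y k) ^ 2) *
          (c (n + 1) ^ 2 + (ext (n + 1) y n) ^ 2)⁻¹ *
          (∏ k ∈ Finset.range n,
            qrad (t (k + 1) - t k) (ext (n + 1) y k) (ext (n + 1) y (k + 1))) *
          (ext (n + 1) y 0) ^ 2)
      (Measure.pi fun _ : Fin (n + 1) => volume.restrict (Set.Ioi (0 : ℝ))) ∧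
    (∫ x : Fin (n + 1) → ℝ,
        Real.exp (-(∑ k ∈ Finset.range (n + 1), c (k + 1) * ext (n + 1) x k)) *
          (Real.sqrt (8 * Real.pi) * hexc (1 - s 1) (ext (n + 1) x 0) *
            htil (s 1) (ext (n + 1) x 0)) *
          (∏ k ∈ Finset.range (n - 1),
            (htil (s (k + 2)) (ext (n + 1) x (k + 1)) / htil (s (k + 1)) (ext (n + 1) x k)) *
              ptilde (s (k + 2) - s (k + 1)) (ext (n + 1) x k) (ext (n + 1) x (k + 1))) *
          (ptilde (1 - s n) (ext (n + 1) x (n - 1)) (ext (n + 1) x n) /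
            (2 * htil (s n) (ext (n + 1) x (n - 1))))
        ∂(Measure.pi fun _ : Fin (n + 1) => volume.restrict (Set.Ioi (0 : ℝ))))
      = Real.sqrt (2 / Real.pi) *
        ∫ y : Fin (n + 1) → ℝ,
          Real.exp (-(1 / 2) * ∑ k ∈ Finset.range (n + 1),
              (s (k + 1) - s k) * (ext (n + 1) y k) ^ 2) *
            (c (n + 1) ^ 2 + (ext (n + 1) y n) ^ 2)⁻¹ *
            (∏ k ∈ Finset.range n,
              qrad (t (k + 1) - t k) (ext (n + 1) y k) (ext (n + 1) y (k + 1))) *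
            (ext (n + 1) y 0) ^ 2
          ∂(Measure.pi fun _ : Fin (n + 1) => volume.restrict (Set.Ioi (0 : ℝ))) := by
  obtain ⟨m, rfl⟩ : ∃ m, n = m + 1 := ⟨n - 1, by omega⟩
  have hp := Real.pi_pos
  obtain ⟨hdual, hfin⟩ := chainIntegral_duality_one hsmono hc hcn
  have hδ : ∀ k < m + 1, 0 < s (k + 2) - s (k + 1) := fun k hk =>
    sub_pos.2 (hsmono (k + 1) (by omega))
  have hfin' := hdual ▸ hfin
  replace hfin' := fun h => hfin' ((congrArg _ h).trans
    (ENNReal.mul_top (ENNReal.ofReal_pos.2 (by positivity)).ne'))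
  obtain ⟨hint, heq⟩ := integrable_chain (m := m + 1)
    (f := hexc (1 - (s 1 - s 0)))
    (w := fun k x z => Real.exp (-(c (k + 1) * x)) * ptilde (s (k + 2) - s (k + 1)) x z)
    (g := fun x => Real.exp (-(c (m + 2) * x))) (by unfold hexc; fun_prop)
    (fun k => ((by fun_prop : Measurable fun p : ℝ × ℝ => Real.exp (-(c (k + 1) * p.1))).mul
      (measurable_ptilde _))) (by fun_prop)
    (fun x hx => by
      have := sub_pos.2 (hsmono 0 (by omega))
      unfold hexc
      positivity)
    (fun k hk x hx z hz => mul_nonneg (Real.exp_pos _).le (ptilde_nonneg (hδ k hk) hx hz))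
    (fun x _ => (Real.exp_pos _).le) hfin
  obtain ⟨hint', heq'⟩ := integrable_chain (m := m + 1) (f := fun y => y)
    (w := fun k y z => gaussWeight (s (k + 1) - s k) y *
      (cauchyKernel (c (k + 1)) y z / Real.pi))
    (g := fun y => gaussWeight (s (m + 2) - s (m + 1)) y * (y / (c (m + 2) ^ 2 + y ^ 2)))
    measurable_id
    (fun k => ((measurable_gaussWeight _).comp measurable_fst).mul
      ((measurable_cauchyKernel _).div_const _))
    ((measurable_gaussWeight _).mul (by fun_prop)) (fun x hx => hx.le)
    (fun k hk y hy z hz => mul_nonneg (gaussWeight_pos _ _).le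
      (div_nonneg (cauchyKernel_nonneg (hc (k + 1) (by omega) (by omega)) hy hz) hp.le))
    (fun y hy => mul_nonneg (gaussWeight_pos _ _).le (by positivity)) hfin'
  have hpos := ae_pi_posVol_pos (m + 1 + 1)
  have hae := hpos.mono fun x hx =>
    meander_density_eq (c := c) (X := ext (m + 1 + 1) x) hs0 hs1 hsmono fun k hk => ext_pos hx hk
  have hae' := hpos.mono fun y hy =>
    cauchy_density_eq (s := s) (Y := ext (m + 1 + 1) y) ht fun k hk => ext_pos hy hk
  refine ⟨(hint.const_mul (Real.sqrt (2 * Real.pi))).congr (hae.mono fun x hx => hx.symm),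
    hint'.congr (hae'.mono fun y hy => hy.symm), ?_⟩
  refine (integral_congr_ae hae).trans (Eq.trans ?_ (congrArg _ (integral_congr_ae hae').symm))
  rw [integral_const_mul]
  refine (congrArg _ (heq.trans (congrArg _ hdual))).trans
    (Eq.trans ?_ (congrArg _ heq').symm)
  rw [ENNReal.toReal_mul, ENNReal.toReal_ofReal (by positivity), ← mul_assoc]
  congr 1
  rw [show 2 / Real.pi = 2 * Real.pi / Real.pi ^ 2 by field_simp, Real.sqrt_div (by positivity),
    Real.sqrt_sq hp.le, mul_one_div]
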